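/- arXiv:1109.6789 — 4 statements merged into one kernel-verified Lean document; each statement's English description precedes it below -/
import Mathlib

section
/- Let d ≥ 1 and let G be any subgroup of the group Q = {g(σ,h) : σ ∈ Sym(d,ℝ), h ∈ GL(d,ℝ)} of lower block-triangular symplectic matrices. Define H = {h ∈ GL(d,ℝ) : g(σ,h) ∈ G for some σ ∈ Sym(d,ℝ)} and Σ = {σ ∈ Sym(d,ℝ) : g(σ,I_d) ∈ G}. Then: H is a subgroup of GL(d,ℝ); Σ is an additive subgroup of Sym(d,ℝ); for every h ∈ H one has h†[Σ] = Σ; and there exists a function τ : H → Sym(d,ℝ) such that τ(I_d) = 0, τ(h) + h†[τ(h')] − τ(hh') ∈ Σ for all h, h' ∈ H, and G = {g(σ + τ(h), h) : σ ∈ Σ, h ∈ H}. -/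
open Matrix

noncomputable section

/-- Real symmetric `d × d` matrices. -/
def SymSet (d : ℕ) : Set (Matrix (Fin d) (Fin d) ℝ) := {σ | σᵀ = σ}

/-- The standard symplectic form `J = [[0, I], [-I, 0]]`. -/
def Jmat (d : ℕ) : Matrix (Fin d ⊕ Fin d) (Fin d ⊕ Fin d) ℝ := fromBlocks 0 1 (-1) 0

/-- The symplectic group `Sp(d, ℝ)` as a set of `2d × 2d` matrices. -/
def SpSet (d : ℕ) : Set (Matrix (Fin d ⊕ Fin d) (Fin d ⊕ Fin d) ℝ) :=
  {g | gᵀ * Jmat d * g = Jmat d}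

/-- The block matrix `g(σ, h) = [[h, 0], [σh, ᵀh⁻¹]]`. -/
def gmat {d : ℕ} (σ h : Matrix (Fin d) (Fin d) ℝ) :
    Matrix (Fin d ⊕ Fin d) (Fin d ⊕ Fin d) ℝ :=
  fromBlocks h 0 (σ * h) h⁻¹ᵀ

/-- The action `h†[σ] = ᵀh⁻¹ σ h⁻¹`. -/
def dag {d : ℕ} (h σ : Matrix (Fin d) (Fin d) ℝ) : Matrix (Fin d) (Fin d) ℝ :=
  h⁻¹ᵀ * σ * h⁻¹

/-- The maximal parabolic `Q = {g(σ,h) : σ ∈ Sym(d,ℝ), h ∈ GL(d,ℝ)}`. -/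
def QSet (d : ℕ) : Set (Matrix (Fin d ⊕ Fin d) (Fin d ⊕ Fin d) ℝ) :=
  {g | ∃ σ ∈ SymSet d, ∃ h : Matrix (Fin d) (Fin d) ℝ, IsUnit h ∧ g = gmat σ h}

theorem dag_dag' {d : ℕ} (h k σ : Matrix (Fin d) (Fin d) ℝ) :
    dag h (dag k σ) = dag (h * k) σ := by
  simp only [dag, Matrix.mul_inv_rev, Matrix.transpose_mul, Matrix.mul_assoc]

theorem dag_one' {d : ℕ} (σ : Matrix (Fin d) (Fin d) ℝ) : dag 1 σ = σ := by
  simp [dag]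

theorem dag_neg' {d : ℕ} (h σ : Matrix (Fin d) (Fin d) ℝ) : dag h (-σ) = -dag h σ := by
  simp [dag]

theorem dag_sym {d : ℕ} (h σ : Matrix (Fin d) (Fin d) ℝ) (hs : σ ∈ SymSet d) :
    dag h σ ∈ SymSet d := by
  have hs' : σᵀ = σ := hs
  show (dag h σ)ᵀ = dag h σ
  simp only [dag, Matrix.transpose_mul, Matrix.transpose_transpose, hs', Matrix.mul_assoc]

theorem gmat_mul {d : ℕ} (σ h σ' h' : Matrix (Fin d) (Fin d) ℝ) (hh : IsUnit h) :
    gmat σ h * gmat σ' h' = gmat (σ + dag h σ') (h * h') := by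
  have h1 : h⁻¹ * h = 1 := Matrix.nonsing_inv_mul h ((Matrix.isUnit_iff_isUnit_det h).1 hh)
  have h2 : h⁻¹ * (h * h') = h' := by rw [← Matrix.mul_assoc, h1, Matrix.one_mul]
  simp only [gmat, dag, Matrix.fromBlocks_multiply, Matrix.mul_inv_rev, Matrix.transpose_mul,
    Matrix.add_mul, Matrix.mul_assoc, h2, Matrix.mul_zero, Matrix.zero_mul, add_zero, zero_add]

theorem gmat_zero_one (d : ℕ) : gmat (0 : Matrix (Fin d) (Fin d) ℝ) 1 = 1 := by
  simp [gmat]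

theorem gmat_inv {d : ℕ} (σ h : Matrix (Fin d) (Fin d) ℝ) (hh : IsUnit h) :
    (gmat σ h)⁻¹ = gmat (-dag h⁻¹ σ) h⁻¹ := by
  have h1 : h * h⁻¹ = 1 := Matrix.mul_nonsing_inv h ((Matrix.isUnit_iff_isUnit_det h).1 hh)
  apply Matrix.inv_eq_right_inv
  rw [gmat_mul _ _ _ _ hh, dag_neg', dag_dag', h1, dag_one', add_neg_cancel, gmat_zero_one]

theorem stmt0 (d : ℕ) (hd : 1 ≤ d)
    (G : Set (Matrix (Fin d ⊕ Fin d) (Fin d ⊕ Fin d) ℝ))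
    (hGQ : G ⊆ QSet d)
    (hGone : (1 : Matrix (Fin d ⊕ Fin d) (Fin d ⊕ Fin d) ℝ) ∈ G)
    (hGmul : ∀ x ∈ G, ∀ y ∈ G, x * y ∈ G)
    (hGinv : ∀ x ∈ G, x⁻¹ ∈ G) :
    let H : Set (Matrix (Fin d) (Fin d) ℝ) :=
      {h | IsUnit h ∧ ∃ σ ∈ SymSet d, gmat σ h ∈ G}
    let S : Set (Matrix (Fin d) (Fin d) ℝ) :=
      {σ | σ ∈ SymSet d ∧ gmat σ 1 ∈ G}
    -- `H` is a subgroup of `GL(d, ℝ)`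
    ((1 : Matrix (Fin d) (Fin d) ℝ) ∈ H) ∧
    (∀ h ∈ H, ∀ h' ∈ H, h * h' ∈ H) ∧
    (∀ h ∈ H, h⁻¹ ∈ H) ∧
    -- `S` is an additive subgroup of `Sym(d, ℝ)`
    ((0 : Matrix (Fin d) (Fin d) ℝ) ∈ S) ∧
    (∀ σ ∈ S, ∀ σ' ∈ S, σ + σ' ∈ S) ∧
    (∀ σ ∈ S, -σ ∈ S) ∧
    -- `h†[S] = S` for every `h ∈ H`
    (∀ h ∈ H, dag h '' S = S) ∧
    -- existence of `τ`
    (∃ τ : Matrix (Fin d) (Fin d) ℝ → Matrix (Fin d) (Fin d) ℝ,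
      τ 1 = 0 ∧
      (∀ h ∈ H, τ h ∈ SymSet d) ∧
      (∀ h ∈ H, ∀ h' ∈ H, τ h + dag h (τ h') - τ (h * h') ∈ S) ∧
      G = {g | ∃ σ ∈ S, ∃ h ∈ H, g = gmat (σ + τ h) h}) := by
  intro H S
  have hinv : ∀ h : Matrix (Fin d) (Fin d) ℝ, IsUnit h → h * h⁻¹ = 1 := fun h hh =>
    Matrix.mul_nonsing_inv h ((Matrix.isUnit_iff_isUnit_det h).1 hh)
  have symadd : ∀ a ∈ SymSet d, ∀ b ∈ SymSet d, a + b ∈ SymSet d := by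
    intro a ha b hb
    have ha' : aᵀ = a := ha
    have hb' : bᵀ = b := hb
    show (a + b)ᵀ = a + b
    rw [Matrix.transpose_add, ha', hb']
  have symneg : ∀ a ∈ SymSet d, -a ∈ SymSet d := by
    intro a ha
    have ha' : aᵀ = a := ha
    show (-a)ᵀ = -a
    rw [Matrix.transpose_neg, ha']
  have sym0 : (0 : Matrix (Fin d) (Fin d) ℝ) ∈ SymSet d := Matrix.transpose_zero
  have D : ∀ σ ∈ SymSet d, ∀ σ' ∈ SymSet d, ∀ h, IsUnit h → gmat σ h ∈ G → gmat σ' h ∈ G →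
      σ - σ' ∈ S := by
    intro σ hs σ' hs' h hh h1 h2
    refine ⟨by rw [sub_eq_add_neg]; exact symadd _ hs _ (symneg _ hs'), ?_⟩
    have h3 := hGmul _ h1 _ (hGinv _ h2)
    rwa [gmat_inv _ _ hh, gmat_mul _ _ _ _ hh, dag_neg', dag_dag', hinv h hh, dag_one',
      ← sub_eq_add_neg] at h3
  have g01 : gmat (0 : Matrix (Fin d) (Fin d) ℝ) 1 ∈ G := by rw [gmat_zero_one]; exact hGone
  have Hmul : ∀ h ∈ H, ∀ h' ∈ H, h * h' ∈ H := by
    rintro h ⟨hh, σ, hs, hg⟩ h' ⟨hh', σ', hs', hg'⟩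
    refine ⟨hh.mul hh', σ + dag h σ', symadd _ hs _ (dag_sym _ _ hs'), ?_⟩
    rw [← gmat_mul _ _ _ _ hh]
    exact hGmul _ hg _ hg'
  have Hinv : ∀ h ∈ H, h⁻¹ ∈ H := by
    rintro h ⟨hh, σ, hs, hg⟩
    refine ⟨?_, -dag h⁻¹ σ, symneg _ (dag_sym _ _ hs), ?_⟩
    · exact (Matrix.isUnit_nonsing_inv_iff).2 hh
    · rw [← gmat_inv _ _ hh]
      exact hGinv _ hg
  have Sneg : ∀ σ ∈ S, -σ ∈ S := by
    rintro σ ⟨hs, hg⟩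
    have := D 0 sym0 σ hs 1 isUnit_one g01 hg
    rwa [zero_sub] at this
  have Sadd : ∀ σ ∈ S, ∀ σ' ∈ S, σ + σ' ∈ S := by
    rintro σ ⟨hs, hg⟩ σ' ⟨hs', hg'⟩
    refine ⟨symadd _ hs _ hs', ?_⟩
    have := hGmul _ hg _ hg'
    rwa [gmat_mul _ _ _ _ isUnit_one, dag_one', Matrix.one_mul] at this
  have Sdag : ∀ h ∈ H, ∀ σ ∈ S, dag h σ ∈ S := by
    rintro h ⟨hh, τ, ht, hgt⟩ σ ⟨hs, hg⟩
    have h1 := hGmul _ hgt _ hg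
    rw [gmat_mul _ _ _ _ hh, Matrix.mul_one] at h1
    have := D _ (symadd _ ht _ (dag_sym h _ hs)) τ ht h hh h1 hgt
    rwa [add_sub_cancel_left] at this
  refine ⟨⟨isUnit_one, 0, sym0, g01⟩, Hmul, Hinv, ⟨sym0, g01⟩, Sadd, Sneg, ?_, ?_⟩
  · intro h hH
    apply Set.Subset.antisymm
    · rintro _ ⟨σ, hσ, rfl⟩
      exact Sdag h hH σ hσ
    · intro σ hσ
      exact ⟨dag h⁻¹ σ, Sdag _ (Hinv h hH) σ hσ, by rw [dag_dag', hinv h hH.1, dag_one']⟩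
  · have ex : ∀ h : Matrix (Fin d) (Fin d) ℝ, ∃ t : Matrix (Fin d) (Fin d) ℝ,
        (h = 1 → t = 0) ∧ (h ∈ H → t ∈ SymSet d ∧ gmat t h ∈ G) := by
      intro h
      by_cases h1 : h = 1
      · subst h1
        exact ⟨0, fun _ => rfl, fun _ => ⟨sym0, g01⟩⟩
      · by_cases hH : h ∈ H
        · obtain ⟨hh, σ, hs, hg⟩ := hH
          exact ⟨σ, fun h2 => absurd h2 h1, fun _ => ⟨hs, hg⟩⟩
        · exact ⟨0, fun _ => rfl, fun h2 => absurd h2 hH⟩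
    choose τ hτ1 hτ using ex
    refine ⟨τ, hτ1 1 rfl, fun h hH => (hτ h hH).1, ?_, ?_⟩
    · intro h hH h' hH'
      obtain ⟨a1, a2⟩ := hτ h hH
      obtain ⟨b1, b2⟩ := hτ h' hH'
      obtain ⟨c1, c2⟩ := hτ (h * h') (Hmul h hH h' hH')
      refine D _ (symadd _ a1 _ (dag_sym _ _ b1)) _ c1 (h * h') (hH.1.mul hH'.1) ?_ c2
      rw [← gmat_mul _ _ _ _ hH.1]
      exact hGmul _ a2 _ b2
    · apply Set.Subset.antisymm
      · intro g hg
        obtain ⟨σ, hs, h, hh, rfl⟩ := hGQ hg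
        have hH : h ∈ H := ⟨hh, σ, hs, hg⟩
        obtain ⟨a1, a2⟩ := hτ h hH
        exact ⟨σ - τ h, D _ hs _ a1 h hh hg a2, h, hH, by rw [sub_add_cancel]⟩
      · rintro _ ⟨σ, hσ, h, hH, rfl⟩
        have := hGmul _ hσ.2 _ (hτ h hH).2
        rwa [gmat_mul _ _ _ _ isUnit_one, dag_one', Matrix.one_mul] at this
end
end

section
/- Let d ≥ 1, let Σ be an additive subgroup of Sym(d,ℝ), let H be a subgroup of GL(d,ℝ) with h†[Σ] = Σ for all h ∈ H, and let τ : H → Sym(d,ℝ) be a function satisfying τ(I_d) = 0 and τ(h) + h†[τ(h')] − τ(hh') ∈ Σ for all h, h' ∈ H. Then G := {g(σ + τ(h), h) : σ ∈ Σ, h ∈ H} is a subgroup of Sp(d,ℝ) contained in Q, and moreover {h ∈ GL(d,ℝ) : g(σ,h) ∈ G for some σ} = H and {σ ∈ Sym(d,ℝ) : g(σ,I_d) ∈ G} = Σ. -/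
open Matrix

noncomputable section

theorem gmat_mul_aux {d : ℕ} (a b h k : Matrix (Fin d) (Fin d) ℝ) (hh : IsUnit h) :
    gmat a h * gmat b k = gmat (a + dag h b) (h * k) := by
  have h1 : h⁻¹ * h = 1 := Matrix.nonsing_inv_mul h ((Matrix.isUnit_iff_isUnit_det h).1 hh)
  have h2 : h⁻¹ᵀ * b * h⁻¹ * (h * k) = h⁻¹ᵀ * (b * k) := by
    calc h⁻¹ᵀ * b * h⁻¹ * (h * k) = h⁻¹ᵀ * b * (h⁻¹ * h) * k := by simp only [Matrix.mul_assoc]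
      _ = _ := by rw [h1, Matrix.mul_one, Matrix.mul_assoc]
  unfold gmat dag
  rw [Matrix.fromBlocks_multiply, Matrix.add_mul, h2, Matrix.mul_inv_rev, Matrix.transpose_mul]
  simp [Matrix.mul_assoc]

theorem gmat_one_aux {d : ℕ} : gmat (0 : Matrix (Fin d) (Fin d) ℝ) 1 = 1 := by
  simp [gmat]

theorem dag_add_aux {d : ℕ} (h a b : Matrix (Fin d) (Fin d) ℝ) :
    dag h (a + b) = dag h a + dag h b := by
  simp [dag, Matrix.mul_add, Matrix.add_mul]

theorem gmat_sp_aux {d : ℕ} (a h : Matrix (Fin d) (Fin d) ℝ) (hh : IsUnit h) (ha : aᵀ = a) :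
    gmat a h ∈ SpSet d := by
  have h1 : h⁻¹ * h = 1 := Matrix.nonsing_inv_mul h ((Matrix.isUnit_iff_isUnit_det h).1 hh)
  have h3 : hᵀ * h⁻¹ᵀ = 1 := by rw [← Matrix.transpose_mul, h1, Matrix.transpose_one]
  show (gmat a h)ᵀ * Jmat d * gmat a h = Jmat d
  unfold gmat Jmat
  rw [Matrix.fromBlocks_transpose, Matrix.fromBlocks_multiply, Matrix.fromBlocks_multiply]
  simp [Matrix.transpose_mul, ha, h1, h3, Matrix.mul_assoc]

theorem stmt1 (d : ℕ) (hd : 1 ≤ d)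
    (S : Set (Matrix (Fin d) (Fin d) ℝ))
    (H : Set (Matrix (Fin d) (Fin d) ℝ))
    -- `S` is an additive subgroup of `Sym(d, ℝ)`
    (hSsym : S ⊆ SymSet d)
    (hSzero : (0 : Matrix (Fin d) (Fin d) ℝ) ∈ S)
    (hSadd : ∀ σ ∈ S, ∀ σ' ∈ S, σ + σ' ∈ S)
    (hSneg : ∀ σ ∈ S, -σ ∈ S)
    -- `H` is a subgroup of `GL(d, ℝ)`
    (hHunit : ∀ h ∈ H, IsUnit h)
    (hHone : (1 : Matrix (Fin d) (Fin d) ℝ) ∈ H)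
    (hHmul : ∀ h ∈ H, ∀ h' ∈ H, h * h' ∈ H)
    (hHinv : ∀ h ∈ H, h⁻¹ ∈ H)
    -- `h†[S] = S` for every `h ∈ H`
    (hact : ∀ h ∈ H, dag h '' S = S)
    -- the map `τ`
    (τ : Matrix (Fin d) (Fin d) ℝ → Matrix (Fin d) (Fin d) ℝ)
    (hτsym : ∀ h ∈ H, τ h ∈ SymSet d)
    (hτone : τ 1 = 0)
    (hτcocycle : ∀ h ∈ H, ∀ h' ∈ H, τ h + dag h (τ h') - τ (h * h') ∈ S) :
    let G : Set (Matrix (Fin d ⊕ Fin d) (Fin d ⊕ Fin d) ℝ) :=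
      {g | ∃ σ ∈ S, ∃ h ∈ H, g = gmat (σ + τ h) h}
    -- `G` is a subgroup of `Sp(d, ℝ)` contained in `Q`
    (G ⊆ SpSet d) ∧ (G ⊆ QSet d) ∧
    ((1 : Matrix (Fin d ⊕ Fin d) (Fin d ⊕ Fin d) ℝ) ∈ G) ∧
    (∀ x ∈ G, ∀ y ∈ G, x * y ∈ G) ∧
    (∀ x ∈ G, x⁻¹ ∈ G) ∧
    -- `G` recovers `H` and `S`
    ({h : Matrix (Fin d) (Fin d) ℝ | IsUnit h ∧ ∃ σ ∈ SymSet d, gmat σ h ∈ G} = H) ∧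
    ({σ : Matrix (Fin d) (Fin d) ℝ | σ ∈ SymSet d ∧ gmat σ 1 ∈ G} = S) := by
  have hdag : ∀ h ∈ H, ∀ σ ∈ S, dag h σ ∈ S := fun h hh σ hσ => by
    rw [← hact h hh]; exact ⟨σ, hσ, rfl⟩
  have hsym : ∀ σ ∈ S, ∀ h ∈ H, (σ + τ h)ᵀ = σ + τ h := fun σ hσ h hh => by
    rw [Matrix.transpose_add, show σᵀ = σ from hSsym hσ, show (τ h)ᵀ = τ h from hτsym h hh]
  intro G
  refine ⟨?_, ?_, ?_, ?_, ?_, ?_, ?_⟩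
  · rintro _ ⟨σ, hσ, h, hh, rfl⟩
    exact gmat_sp_aux _ _ (hHunit h hh) (hsym σ hσ h hh)
  · rintro _ ⟨σ, hσ, h, hh, rfl⟩
    exact ⟨_, hsym σ hσ h hh, h, hHunit h hh, rfl⟩
  · exact ⟨0, hSzero, 1, hHone, by rw [hτone, add_zero, gmat_one_aux]⟩
  · rintro _ ⟨σ, hσ, h, hh, rfl⟩ _ ⟨σ', hσ', k, hk, rfl⟩
    refine ⟨σ + dag h σ' + (τ h + dag h (τ k) - τ (h * k)),
      hSadd _ (hSadd _ hσ _ (hdag h hh _ hσ')) _ (hτcocycle h hh k hk), h * k, hHmul h hh k hk, ?_⟩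
    rw [gmat_mul_aux _ _ _ _ (hHunit h hh), dag_add_aux]
    congr 1
    abel
  · rintro _ ⟨σ, hσ, h, hh, rfl⟩
    have hdet := (Matrix.isUnit_iff_isUnit_det h).1 (hHunit h hh)
    have h1 : h⁻¹ * h = 1 := Matrix.nonsing_inv_mul h hdet
    have hc := hτcocycle h⁻¹ (hHinv h hh) h hh
    rw [h1, hτone, sub_zero] at hc
    refine ⟨-dag h⁻¹ σ + -(τ h⁻¹ + dag h⁻¹ (τ h)),
      hSadd _ (hSneg _ (hdag _ (hHinv h hh) _ hσ)) _ (hSneg _ hc), h⁻¹, hHinv h hh, ?_⟩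
    apply Matrix.inv_eq_left_inv
    rw [gmat_mul_aux _ _ _ _ (hHunit _ (hHinv h hh)), h1, dag_add_aux, ← gmat_one_aux]
    congr 1
    abel
  · ext h
    constructor
    · rintro ⟨_, σ, _, σ', _, k, hk, he⟩
      have := (Matrix.fromBlocks_inj.1 he).1
      rw [this]; exact hk
    · intro hh
      exact ⟨hHunit h hh, 0 + τ h, hsym 0 hSzero h hh, 0, hSzero, h, hh, rfl⟩
  · ext σ
    constructor
    · rintro ⟨_, σ', hσ', k, hk, he⟩
      obtain ⟨e1, _, e3, _⟩ := Matrix.fromBlocks_inj.1 he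
      subst e1
      rw [hτone, add_zero, Matrix.mul_one, Matrix.mul_one] at e3
      rw [e3]; exact hσ'
    · intro hσ
      exact ⟨hSsym hσ, σ, hσ, 1, hHone, by rw [hτone, add_zero]⟩
end
end

section
/- Let B = [[0,0],[1,0]], σ₄ = [[0,0],[0,1]], I = I₂, and let T = {[[c,0],[b,a]] : a,b,c ∈ ℝ, ac ≠ 0} be the group of invertible lower triangular real 2×2 matrices. For γ, γ', β, β' ∈ ℝ, there exists ℓ ∈ T such that ℓ·span{γI + βB + σ₄}·ℓ⁻¹ = span{γ'I + β'B + σ₄} if and only if γ = γ'. -/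
open Matrix

noncomputable section

/-- `B = [[0,0],[1,0]]`. -/
def Bm : Matrix (Fin 2) (Fin 2) ℝ := !![0, 0; 1, 0]

/-- `σ₄ = [[0,0],[0,1]]`. -/
def sigma4 : Matrix (Fin 2) (Fin 2) ℝ := !![0, 0; 0, 1]

/-- The group `T` of invertible lower triangular real `2 × 2` matrices. -/
def Tgrp : Set (Matrix (Fin 2) (Fin 2) ℝ) :=
  {m | ∃ a b c : ℝ, a * c ≠ 0 ∧ m = !![c, 0; b, a]}

/-- Conjugation of a set of matrices: `ℓ·S·ℓ⁻¹`. -/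
def conjSet (g : Matrix (Fin 2) (Fin 2) ℝ) (S : Set (Matrix (Fin 2) (Fin 2) ℝ)) :
    Set (Matrix (Fin 2) (Fin 2) ℝ) :=
  (fun X => g * X * g⁻¹) '' S

theorem stmt10 (γ γ' β β' : ℝ) :
    (∃ ℓ ∈ Tgrp, conjSet ℓ
        (Submodule.span ℝ {γ • (1 : Matrix (Fin 2) (Fin 2) ℝ) + β • Bm + sigma4} :
          Submodule ℝ (Matrix (Fin 2) (Fin 2) ℝ)) =
      (Submodule.span ℝ {γ' • (1 : Matrix (Fin 2) (Fin 2) ℝ) + β' • Bm + sigma4} :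
        Submodule ℝ (Matrix (Fin 2) (Fin 2) ℝ))) ↔ γ = γ' := by
  constructor
  · rintro ⟨ℓ, ⟨a, b, c, hac, rfl⟩, h⟩
    have ha : a ≠ 0 := left_ne_zero_of_mul hac
    have hc : c ≠ 0 := right_ne_zero_of_mul hac
    have hdet : IsUnit (!![c, 0; b, a] : Matrix (Fin 2) (Fin 2) ℝ).det := by
      simp [Matrix.det_fin_two, ha, hc]
    have hm : !![c, 0; b, a] * (γ • (1 : Matrix (Fin 2) (Fin 2) ℝ) + β • Bm + sigma4) *
        (!![c, 0; b, a])⁻¹ ∈ (Submodule.span ℝ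
          {γ' • (1 : Matrix (Fin 2) (Fin 2) ℝ) + β' • Bm + sigma4} :
        Submodule ℝ (Matrix (Fin 2) (Fin 2) ℝ)) := by
      rw [← SetLike.mem_coe, ← h]
      exact ⟨_, Submodule.mem_span_singleton_self _, rfl⟩
    obtain ⟨t, ht⟩ := Submodule.mem_span_singleton.1 hm
    have h2 := congrArg (fun X => X * !![c, 0; b, a]) ht
    simp only [Matrix.nonsing_inv_mul_cancel_right _ _ hdet] at h2
    have h00 := congrFun (congrFun h2 0) 0
    have h11 := congrFun (congrFun h2 1) 1
    simp [Bm, sigma4, Matrix.mul_apply, Fin.sum_univ_two] at h00 h11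
    have e1 : t * γ' = γ := mul_right_cancel₀ hc (by linarith)
    have e2 : t * (γ' + 1) = γ + 1 := mul_right_cancel₀ ha (by linarith)
    have e3 : t = 1 := by linarith
    subst e3
    linarith
  · rintro rfl
    refine ⟨!![1, 0; β - β', 1], ⟨1, β - β', 1, by norm_num, rfl⟩, ?_⟩
    have hdet : IsUnit (!![1, 0; β - β', 1] : Matrix (Fin 2) (Fin 2) ℝ).det := by
      simp [Matrix.det_fin_two]
    have key : !![1, 0; β - β', 1] * (γ • (1 : Matrix (Fin 2) (Fin 2) ℝ) + β • Bm + sigma4) *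
        (!![1, 0; β - β', 1])⁻¹ = γ • (1 : Matrix (Fin 2) (Fin 2) ℝ) + β' • Bm + sigma4 := by
      have : !![1, 0; β - β', 1] * (γ • (1 : Matrix (Fin 2) (Fin 2) ℝ) + β • Bm + sigma4) =
          (γ • (1 : Matrix (Fin 2) (Fin 2) ℝ) + β' • Bm + sigma4) * !![1, 0; β - β', 1] := by
        ext i j
        fin_cases i <;> fin_cases j <;>
          simp [Bm, sigma4, Matrix.mul_apply, Fin.sum_univ_two] <;> ring
      rw [this, Matrix.mul_nonsing_inv_cancel_right _ _ hdet]
    ext X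
    simp only [conjSet, Set.mem_image, SetLike.mem_coe, Submodule.mem_span_singleton]
    constructor
    · rintro ⟨_, ⟨t, rfl⟩, rfl⟩
      exact ⟨t, by rw [← key, Matrix.mul_smul, Matrix.smul_mul]⟩
    · rintro ⟨t, rfl⟩
      exact ⟨_, ⟨t, rfl⟩, by rw [← key, Matrix.mul_smul, Matrix.smul_mul]⟩
end
end

section
/- Let 𝔥(σ₃) = {[[c,0],[b,a]] : a,b,c ∈ ℝ} be the Lie algebra of lower triangular real 2×2 matrices (with bracket [X,Y] = XY − YX), and let T be the group of invertible lower triangular 2×2 matrices. Let 𝔥 be a 2-dimensional vector subspace of 𝔥(σ₃) closed under the commutator bracket. Then there exists ℓ ∈ T such that ℓ·𝔥·ℓ⁻¹ is one of: 𝔨₀ = span{I, σ₄}, 𝔨_∞ = span{I, B}, or 𝔩_γ = span{B, γI + σ₄} for some γ ∈ ℝ. Moreover these algebras are mutually non-conjugate by elements of T: no ℓ ∈ T conjugates any two distinct algebras in the list {𝔨₀, 𝔨_∞} ∪ {𝔩_γ : γ ∈ ℝ} onto one another. -/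
open Matrix

noncomputable section

/-- `𝔨₀ = span{I, σ₄}`. -/
def k0 : Set (Matrix (Fin 2) (Fin 2) ℝ) :=
  (Submodule.span ℝ {(1 : Matrix (Fin 2) (Fin 2) ℝ), sigma4} :
    Submodule ℝ (Matrix (Fin 2) (Fin 2) ℝ))

/-- `𝔨_∞ = span{I, B}`. -/
def kinf : Set (Matrix (Fin 2) (Fin 2) ℝ) :=
  (Submodule.span ℝ {(1 : Matrix (Fin 2) (Fin 2) ℝ), Bm} :
    Submodule ℝ (Matrix (Fin 2) (Fin 2) ℝ))

/-- `𝔩_γ = span{B, γI + σ₄}`. -/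
def lgam (γ : ℝ) : Set (Matrix (Fin 2) (Fin 2) ℝ) :=
  (Submodule.span ℝ {Bm, γ • (1 : Matrix (Fin 2) (Fin 2) ℝ) + sigma4} :
    Submodule ℝ (Matrix (Fin 2) (Fin 2) ℝ))

lemma k0_mem (X : Matrix (Fin 2) (Fin 2) ℝ) : X ∈ k0 ↔ X 0 1 = 0 ∧ X 1 0 = 0 := by
  simp only [k0, SetLike.mem_coe, Submodule.mem_span_pair]
  constructor
  · rintro ⟨s, t, rfl⟩
    simp [sigma4]
  · rintro ⟨h1, h2⟩
    refine ⟨X 0 0, X 1 1 - X 0 0, ?_⟩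
    ext i j
    fin_cases i <;> fin_cases j <;> simp [sigma4, h1, h2]

lemma kinf_mem (X : Matrix (Fin 2) (Fin 2) ℝ) : X ∈ kinf ↔ X 0 1 = 0 ∧ X 0 0 = X 1 1 := by
  simp only [kinf, SetLike.mem_coe, Submodule.mem_span_pair]
  constructor
  · rintro ⟨s, t, rfl⟩
    simp [Bm]
  · rintro ⟨h1, h2⟩
    refine ⟨X 0 0, X 1 0, ?_⟩
    ext i j
    fin_cases i <;> fin_cases j <;> simp [Bm, h1, h2]

lemma lgam_mem (γ : ℝ) (X : Matrix (Fin 2) (Fin 2) ℝ) :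
    X ∈ lgam γ ↔ X 0 1 = 0 ∧ (γ + 1) * X 0 0 = γ * X 1 1 := by
  simp only [lgam, SetLike.mem_coe, Submodule.mem_span_pair]
  constructor
  · rintro ⟨s, t, rfl⟩
    simp [Bm, sigma4]
    ring
  · rintro ⟨h1, h2⟩
    refine ⟨X 1 0, X 1 1 - X 0 0, ?_⟩
    ext i j
    fin_cases i <;> fin_cases j <;> simp [Bm, sigma4, h1] <;> linarith

lemma conj_formula {a c : ℝ} (b : ℝ) (h : a * c ≠ 0) (x y z : ℝ) :
    (!![c, 0; b, a] : Matrix (Fin 2) (Fin 2) ℝ) * !![x, 0; y, z] * (!![c, 0; b, a])⁻¹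
      = !![x, 0; (b * x + a * y - b * z) / c, z] := by
  have ha : a ≠ 0 := left_ne_zero_of_mul h
  have hc : c ≠ 0 := right_ne_zero_of_mul h
  have hinv : (!![c, 0; b, a] : Matrix (Fin 2) (Fin 2) ℝ)⁻¹ = !![1 / c, 0; -b / (a * c), 1 / a] := by
    apply Matrix.inv_eq_right_inv
    ext i j
    fin_cases i <;> fin_cases j <;> simp [Matrix.mul_apply, Fin.sum_univ_two] <;> field_simp
    ring
  rw [hinv]
  ext i j
  fin_cases i <;> fin_cases j <;> simp [Matrix.mul_apply, Fin.sum_univ_two] <;> field_simp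
  ring

lemma eta2 (X : Matrix (Fin 2) (Fin 2) ℝ) (h : X 0 1 = 0) :
    X = !![X 0 0, 0; X 1 0, X 1 1] := by
  ext i j
  fin_cases i <;> fin_cases j <;> simp [h]

lemma mem_conj {a c : ℝ} (b : ℝ) (h : a * c ≠ 0) (S : Set (Matrix (Fin 2) (Fin 2) ℝ))
    (hS : ∀ X ∈ S, X 0 1 = 0) (M : Matrix (Fin 2) (Fin 2) ℝ) :
    M ∈ conjSet !![c, 0; b, a] S ↔ M 0 1 = 0 ∧
      !![M 0 0, 0; (c * M 1 0 - b * M 0 0 + b * M 1 1) / a, M 1 1] ∈ S := by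
  have ha : a ≠ 0 := left_ne_zero_of_mul h
  have hc : c ≠ 0 := right_ne_zero_of_mul h
  constructor
  · rintro ⟨X, hX, rfl⟩
    have e := eta2 X (hS X hX)
    generalize X 0 0 = x at e
    generalize X 1 0 = y at e
    generalize X 1 1 = z at e
    subst e
    simp only [conj_formula b h]
    refine ⟨by simp, ?_⟩
    convert hX using 1
    ext i j
    fin_cases i <;> fin_cases j <;> simp
    field_simp
    ring
  · rintro ⟨h1, h2⟩
    refine ⟨_, h2, ?_⟩
    simp only [conj_formula b h]
    ext i j
    fin_cases i <;> fin_cases j <;> simp [h1]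
    field_simp
    ring

lemma functional (H : Submodule ℝ (Matrix (Fin 2) (Fin 2) ℝ))
    (hlow : ∀ X ∈ H, X 0 1 = 0) (hdim : Module.finrank ℝ H = 2)
    (hbr : ∀ X ∈ H, ∀ Y ∈ H, X * Y - Y * X ∈ H) :
    ∃ p q r : ℝ, (p ≠ 0 ∨ q ≠ 0 ∨ r ≠ 0) ∧ q * (p + r) = 0 ∧
      ∀ x y z : ℝ, !![x, 0; y, z] ∈ H ↔ p * x + q * y + r * z = 0 := by
  have : Module.Finite ℝ H := Module.finite_of_finrank_pos (by omega)
  let e := Module.finBasisOfFinrankEq ℝ H hdim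
  obtain ⟨u, hu⟩ : ∃ u : Matrix (Fin 2) (Fin 2) ℝ, u = e 0 := ⟨_, rfl⟩
  obtain ⟨v, hv⟩ : ∃ v : Matrix (Fin 2) (Fin 2) ℝ, v = e 1 := ⟨_, rfl⟩
  have huH : u ∈ H := hu ▸ (e 0).2
  have hvH : v ∈ H := hv ▸ (e 1).2
  have hspan : ∀ X ∈ H, ∃ s t : ℝ, X = s • u + t • v := by
    intro X hX
    have := e.sum_repr ⟨X, hX⟩
    rw [Fin.sum_univ_two] at this
    refine ⟨e.repr ⟨X, hX⟩ 0, e.repr ⟨X, hX⟩ 1, ?_⟩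
    rw [hu, hv]
    exact (congrArg Subtype.val this).symm
  have hind : ∀ s t : ℝ, s • u + t • v = 0 → s = 0 ∧ t = 0 := by
    intro s t hst
    have h2 := Fintype.linearIndependent_iff.1 e.linearIndependent ![s, t] (by
      rw [Fin.sum_univ_two]
      apply Subtype.ext
      simpa [hu, hv] using hst)
    exact ⟨h2 0, h2 1⟩
  have eu := eta2 u (hlow u huH)
  have ev := eta2 v (hlow v hvH)
  clear hu hv
  generalize u 0 0 = x1 at eu
  generalize u 1 0 = y1 at eu
  generalize u 1 1 = z1 at eu
  generalize v 0 0 = x2 at ev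
  generalize v 1 0 = y2 at ev
  generalize v 1 1 = z2 at ev
  subst eu ev
  have hind' : ∀ s t : ℝ, s * x1 + t * x2 = 0 → s * y1 + t * y2 = 0 → s * z1 + t * z2 = 0 →
      s = 0 ∧ t = 0 := by
    intro s t h1 h2 h3
    apply hind
    ext i j
    fin_cases i <;> fin_cases j <;> simp [h1, h2, h3]
  have hcomb : ∀ s t x y z : ℝ, s * x1 + t * x2 = x → s * y1 + t * y2 = y →
      s * z1 + t * z2 = z → !![x, 0; y, z] ∈ H := by
    intro s t x y z h1 h2 h3
    convert H.add_mem (H.smul_mem s huH) (H.smul_mem t hvH) using 1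
    ext i j
    fin_cases i <;> fin_cases j <;> simp [h1, h2, h3]
  have hfwd : ∀ x y z : ℝ, !![x, 0; y, z] ∈ H →
      (y1 * z2 - z1 * y2) * x + (z1 * x2 - x1 * z2) * y + (x1 * y2 - y1 * x2) * z = 0 := by
    intro x y z h
    obtain ⟨s, t, h⟩ := hspan _ h
    have h00 := congrFun (congrFun h 0) 0
    have h10 := congrFun (congrFun h 1) 0
    have h11 := congrFun (congrFun h 1) 1
    simp at h00 h10 h11
    rw [h00, h10, h11]
    ring
  have hne : y1 * z2 - z1 * y2 ≠ 0 ∨ z1 * x2 - x1 * z2 ≠ 0 ∨ x1 * y2 - y1 * x2 ≠ 0 := by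
    by_contra! hc
    obtain ⟨hp, hq, hr⟩ := hc
    have a1 := hind' x2 (-x1) (by ring) (by linarith) (by linarith)
    have a2 := hind' y2 (-y1) (by linarith) (by ring) (by linarith)
    have a3 := hind' z2 (-z1) (by linarith) (by linarith) (by ring)
    have a4 := hind' 1 0 (by linarith) (by linarith) (by linarith)
    exact one_ne_zero a4.1
  refine ⟨_, _, _, hne, ?_, fun x y z => ⟨hfwd x y z, fun h => ?_⟩⟩
  · have hb := hbr _ huH _ hvH
    have h := hfwd 0 (y1 * x2 + z1 * y2 - (y2 * x1 + z2 * y1)) 0 (by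
      convert hb using 1
      ext i j
      fin_cases i <;> fin_cases j <;> simp [Matrix.mul_apply, Fin.sum_univ_two] <;> ring)
    linear_combination -h
  · rcases hne with hp | hq | hr
    · refine hcomb ((y * z2 - z * y2) / (y1 * z2 - z1 * y2))
        ((y1 * z - z1 * y) / (y1 * z2 - z1 * y2)) x y z ?_ ?_ ?_ <;>
        rw [div_mul_eq_mul_div, div_mul_eq_mul_div, ← add_div, div_eq_iff hp] <;>
        first | ring1 | linear_combination h | linear_combination -h
    · refine hcomb ((z * x2 - x * z2) / (z1 * x2 - x1 * z2))
        ((z1 * x - x1 * z) / (z1 * x2 - x1 * z2)) x y z ?_ ?_ ?_ <;>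
        rw [div_mul_eq_mul_div, div_mul_eq_mul_div, ← add_div, div_eq_iff hq] <;>
        first | ring1 | linear_combination h | linear_combination -h
    · refine hcomb ((x * y2 - y * x2) / (x1 * y2 - y1 * x2))
        ((x1 * y - y1 * x) / (x1 * y2 - y1 * x2)) x y z ?_ ?_ ?_ <;>
        rw [div_mul_eq_mul_div, div_mul_eq_mul_div, ← add_div, div_eq_iff hr] <;>
        first | ring1 | linear_combination h | linear_combination -h

theorem stmt11 (𝔥 : Submodule ℝ (Matrix (Fin 2) (Fin 2) ℝ))
    -- `𝔥` consists of lower triangular matrices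
    (hlow : ∀ X ∈ 𝔥, X 0 1 = 0)
    -- `𝔥` is two dimensional
    (hdim : Module.finrank ℝ 𝔥 = 2)
    -- `𝔥` is closed under the commutator bracket
    (hbracket : ∀ X ∈ 𝔥, ∀ Y ∈ 𝔥, X * Y - Y * X ∈ 𝔥) :
    -- classification up to conjugation by `T`
    (∃ ℓ ∈ Tgrp, conjSet ℓ 𝔥 = k0 ∨ conjSet ℓ 𝔥 = kinf ∨ ∃ γ : ℝ, conjSet ℓ 𝔥 = lgam γ) ∧
    -- the listed algebras are mutually non-conjugate by elements of `T`
    (∀ ℓ ∈ Tgrp,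
      conjSet ℓ k0 ≠ kinf ∧ conjSet ℓ kinf ≠ k0 ∧
      (∀ γ : ℝ, conjSet ℓ k0 ≠ lgam γ) ∧ (∀ γ : ℝ, conjSet ℓ (lgam γ) ≠ k0) ∧
      (∀ γ : ℝ, conjSet ℓ kinf ≠ lgam γ) ∧ (∀ γ : ℝ, conjSet ℓ (lgam γ) ≠ kinf) ∧
      (∀ γ γ' : ℝ, γ ≠ γ' → conjSet ℓ (lgam γ) ≠ lgam γ')) := by
  constructor
  · obtain ⟨p, q, r, hne, hq, hmem⟩ := functional 𝔥 hlow hdim hbracket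
    by_cases hq0 : q = 0
    · subst hq0
      have h1 : (1 : ℝ) * 1 ≠ 0 := by norm_num
      refine ⟨!![1, 0; 0, 1], ⟨1, 0, 1, h1, rfl⟩, Or.inr ?_⟩
      by_cases hpr : p + r = 0
      · left
        have hp : p ≠ 0 := by
          rintro rfl
          simp at hpr
          simp [hpr] at hne
        obtain rfl : r = -p := by linarith
        ext M
        rw [mem_conj 0 h1 _ hlow, kinf_mem, SetLike.mem_coe, hmem]
        refine and_congr_right fun _ => ⟨fun h => ?_, fun h => ?_⟩
        · apply mul_left_cancel₀ hp
          linarith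
        · rw [h]; ring
      · right
        refine ⟨-r / (p + r), ?_⟩
        ext M
        rw [mem_conj 0 h1 _ hlow, lgam_mem, SetLike.mem_coe, hmem]
        refine and_congr_right fun _ => ?_
        have : -r / (p + r) + 1 = p / (p + r) := by field_simp; ring
        rw [this, div_mul_eq_mul_div, div_mul_eq_mul_div, div_left_inj' hpr]
        constructor <;> intro h <;> linarith
    · have h1 : q * 1 ≠ 0 := by simpa using hq0
      obtain rfl : r = -p := by
        have := (mul_eq_zero.1 hq).resolve_left hq0
        linarith
      refine ⟨!![1, 0; p, q], ⟨q, p, 1, h1, rfl⟩, Or.inl ?_⟩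
      ext M
      rw [mem_conj p h1 _ hlow, k0_mem, SetLike.mem_coe, hmem, mul_div_cancel₀ _ hq0]
      refine and_congr_right fun _ => ?_
      constructor <;> intro h <;> linarith
  · rintro _ ⟨a, b, c, h, rfl⟩
    have ha : a ≠ 0 := left_ne_zero_of_mul h
    have hc : c ≠ 0 := right_ne_zero_of_mul h
    have key : ∀ (S S' : Set (Matrix (Fin 2) (Fin 2) ℝ)), conjSet !![c, 0; b, a] S = S' →
        ∀ x y z : ℝ, !![x, 0; y, z] ∈ S → !![x, 0; (b * x + a * y - b * z) / c, z] ∈ S' := by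
      rintro S _ rfl x y z hx
      exact ⟨_, hx, conj_formula b h x y z⟩
    refine ⟨fun hS => ?_, fun hS => ?_, fun γ hS => ?_, fun γ hS => ?_, fun γ hS => ?_,
      fun γ hS => ?_, fun γ γ' hγ hS => ?_⟩
    · simpa [kinf_mem] using key _ _ hS 0 0 1 (by simp [k0_mem])
    · simpa [k0_mem, ha, hc] using key _ _ hS 0 1 0 (by simp [kinf_mem])
    · simpa [lgam_mem] using key _ _ hS 1 0 1 (by simp [k0_mem])
    · simpa [k0_mem, ha, hc] using key _ _ hS 0 1 0 (by simp [lgam_mem])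
    · simpa [lgam_mem] using key _ _ hS 1 0 1 (by simp [kinf_mem])
    · simpa [kinf_mem] using key _ _ hS γ 0 (γ + 1) (by simp [lgam_mem]; ring)
    · have := key _ _ hS γ 0 (γ + 1) (by simp [lgam_mem]; ring)
      simp [lgam_mem] at this
      apply hγ
      linarith
end
end
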